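/- arXiv:1407.7265 — 2 statements merged into one kernel-verified Lean document; each statement's English description precedes it below -/
import Mathlib

section
/- Let (S,α) be the twisted K3 surface of a very general cubic fourfold containing a plane, B̃ = ½s + ¼h, and Z_λ(E) = ⟨v^B(E), e^{B̃ + iλh}⟩ for λ > ½. Then for every class E ∈ K(S,α): (i) Im Z_λ(E) ∈ λℤ; and (ii) since α ≠ 1 (so rk E is even), Re Z_λ(E) ∈ ¼ℤ + (rk E / 2)(2λ² + 3/8). -/
noncomputable section

/-- An abstract model of the twisted Mukai lattice of the twisted K3 surface
`(S,α)` of a *very general* cubic fourfold containing a plane:  `S` is a K3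
surface with `Pic S = ℤh`, `h² = 2`, and `α ∈ Br(S)` is a nontrivial Brauer
class of order `2` (so the rank of every object of `D^b(S,α)` is even).

* `H` models `H²(S,ℚ)` with intersection form `pair`; `B ∈ H²(S,½ℤ)` is a
  fixed B-field for `α`;
* `(2, s, t) = v^B(𝒰₀)` is the Mukai vector of the rank-2 spherical twisted
  bundle `𝒰₀`, so `s² − 4t = −2`, `s − 2B ∈ Pic S = ℤh`, `t ∈ ℤ` and
  `½·s·h − ½ ∈ ℤ`;
* a twisted Mukai vector is a triple `(r, c, d) ∈ ℚ × H²(S,ℚ) × ℚ`, and by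
  Macrì–Stellari the twisted Mukai lattice `H̃^{1,1}(S,B,ℤ)` is generated by
  `(2, 2B, 0)`, `Pic S = ℤh` and `(0,0,1)` (`inLattice` below). -/
structure VeryGeneralTwistedK3 where
  H : Type
  [grpH : AddCommGroup H]
  [modH : Module ℚ H]
  pair : H →ₗ[ℚ] H →ₗ[ℚ] ℚ
  pair_symm : ∀ a b, pair a b = pair b a
  h : H
  B : H
  h_sq : pair h h = 2
  s : H
  t : ℤ
  s_sq : pair s s - 4 * t = -2
  /-- `Pic S = ℤh`, and `s − 2B ∈ Pic S` -/
  s_sub_2B : ∃ m : ℤ, s - (2 : ℚ) • B = (m : ℚ) • h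
  /-- `½·s·h − ½ ∈ ℤ`, i.e. `s·h` is odd -/
  sh_odd : ∃ k : ℤ, pair s h = 2 * k + 1

attribute [instance] VeryGeneralTwistedK3.grpH VeryGeneralTwistedK3.modH

namespace VeryGeneralTwistedK3

variable (T : VeryGeneralTwistedK3)

/-- `B̃ = ½·l + ¼·h + B = ½·s + ¼·h`, where `l = s − 2B ∈ Pic S` -/
def Btilde : T.H := (1 / 2 : ℚ) • T.s + (1 / 4 : ℚ) • T.h

/-- membership in the twisted Mukai lattice `H̃^{1,1}(S,B,ℤ)`, generated by
`(2, 2B, 0)`, `Pic S = ℤh` and `(0, 0, 1)` -/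
def inLattice (w : ℚ × T.H × ℚ) : Prop :=
  ∃ a b c : ℤ, w = ((2 * a : ℚ), (2 * a : ℚ) • T.B + (b : ℚ) • T.h, (c : ℚ))

/-- the real part of the central charge
`Z_λ(E) = ⟨v^B(E), e^{B̃ + iλh}⟩`, namely
`Re Z_λ(r,c,d) = c·B̃ − (r/2)·B̃² − d + r·λ²` -/
def ReZ (lam : ℝ) (w : ℚ × T.H × ℚ) : ℝ :=
  ((T.pair w.2.1 T.Btilde - w.1 / 2 * T.pair T.Btilde T.Btilde - w.2.2 : ℚ) : ℝ)
    + (w.1 : ℝ) * lam ^ 2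

/-- the imaginary part of the central charge `Z_λ(E) = ⟨v^B(E), e^{B̃+iλh}⟩`,
namely `Im Z_λ(r,c,d) = λ·(c·h − r·B̃·h)` -/
def ImZ (lam : ℝ) (w : ℚ × T.H × ℚ) : ℝ :=
  lam * ((T.pair w.2.1 T.h - w.1 * T.pair T.Btilde T.h : ℚ) : ℝ)

end VeryGeneralTwistedK3

/-- Let `(S,α)` be the twisted K3 surface of a very general
cubic fourfold containing a plane, `B̃ = ½s + ¼h`, and
`Z_λ(E) = ⟨v^B(E), e^{B̃ + iλh}⟩` for `λ > ½`. Then for every class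
`E ∈ K(S,α)` (equivalently, every vector `(r,c,d)` of the twisted Mukai
lattice): (i) `Im Z_λ(E) ∈ λ·ℤ`; and (ii) since `α ≠ 1` (so `rk E = r` is
even), `Re Z_λ(E) ∈ ¼·ℤ + (r/2)·(2λ² + 3/8)`. -/
theorem central_charge_arithmetic (T : VeryGeneralTwistedK3) (lam : ℝ)
    (hlam : 1 / 2 < lam) (w : ℚ × T.H × ℚ) (hw : T.inLattice w) :
    (∃ k : ℤ, T.ImZ lam w = lam * (k : ℝ)) ∧
    (∃ k : ℤ, T.ReZ lam w = (k : ℝ) / 4 + ((w.1 : ℝ) / 2) * (2 * lam ^ 2 + 3 / 8)) := by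
  obtain ⟨a, b, c, rfl⟩ := hw
  obtain ⟨m, hm⟩ := T.s_sub_2B
  obtain ⟨k, hk⟩ := T.sh_odd
  have hss : T.pair T.s T.s = 4 * T.t - 2 := by linarith [T.s_sq]
  have hks : T.pair T.h T.s = 2 * k + 1 := by rw [T.pair_symm, hk]
  have hh := T.h_sq
  have hc : (2 * a : ℚ) • T.B + (b : ℚ) • T.h = (a : ℚ) • T.s + ((b : ℚ) - a * m) • T.h := by
    have h1 : T.s = (m : ℚ) • T.h + (2 : ℚ) • T.B := by rw [← hm]; abel
    rw [h1]
    module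
  rw [hc]
  constructor
  · refine ⟨2 * (b - a * m) - a, ?_⟩
    unfold VeryGeneralTwistedK3.ImZ
    congr 1
    rw [← Rat.cast_intCast]
    congr 1
    simp only [VeryGeneralTwistedK3.Btilde, map_add, map_smul, LinearMap.add_apply,
      LinearMap.smul_apply, smul_eq_mul, hk, hh]
    push_cast
    ring
  · refine ⟨4 * (a * T.t - a + (b - a * m) * (k + 1) - c), ?_⟩
    unfold VeryGeneralTwistedK3.ReZ
    simp only [VeryGeneralTwistedK3.Btilde, map_add, map_smul, LinearMap.add_apply,
      LinearMap.smul_apply, smul_eq_mul, hk, hh, hks, hss]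
    push_cast
    ring
end
end

section
/- Let (S,α) be the twisted K3 surface of a very general cubic fourfold containing a plane, with Pic S = ℤh, and let Z = Z_λ be the central charge Z(E) = ⟨v^B(E), e^{B̃+iλh}⟩, λ > ½. Let F ∈ D^b(S,α) satisfy Hom(F,F) = ℂ. If Im Z(F) = λ and rk F > 0, then Re Z(F) ≥ 2λ² − 5/8, with equality if and only if v^B(F) = (2, s+h, t + ½sh + ½); if moreover rk F ≥ 4, then Re Z(F) ≥ 4λ² − 5/16. If Im Z(F) = 2λ and rk F > 0, then Re Z(F) > 2λ² − 1; if moreover rk F ≥ 4, then Re Z(F) ≥ 4λ² − ½. -/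
noncomputable section

/-- An abstract model of the derived category `D^b(S,α)` of the twisted K3
surface of a *very general* cubic fourfold containing a plane, together with
its twisted Mukai lattice:  `S` is a K3 surface with `Pic S = ℤh`, `h² = 2`,
and `α ∈ Br(S)` has order `2` (so ranks of objects of `D^b(S,α)` are even).

* `H` models `H²(S,ℚ)` with intersection form `pair`; `B ∈ H²(S,½ℤ)` is a
  fixed B-field for `α`;
* `(2, s, t) = v^B(𝒰₀)` is the Mukai vector of the rank-2 spherical twisted
  bundle `𝒰₀`, so `s² − 4t = −2`, `s − 2B ∈ Pic S = ℤh`, `t ∈ ℤ`,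
  `½·s·h − ½ ∈ ℤ`;
* `Obj` is the class of objects of `D^b(S,α)`,
  `extDim E F n = dim_ℂ Hom(E, F[n])`, `rk` the rank, `v` the twisted Mukai
  vector `(r,c,d) ∈ ℚ × H²(S,ℚ) × ℚ` and `chi` the Euler pairing, with the
  Riemann–Roch formula `χ(E,F) = −⟨v^B(E), v^B(F)⟩` for the Mukai pairing
  `⟨(r,c,d),(r',c',d')⟩ = c·c' − r·d' − d·r'`, and Serre duality
  `Ext²(E,F) ≅ Hom(F,E)^*` on the K3 category;
* every Mukai vector lies in the lattice generated by `(2, 2B, 0)`,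
  `Pic S = ℤh` and `(0,0,1)` (field `v_mem`). -/
structure VeryGeneralTwistedK3Cat where
  H : Type
  [grpH : AddCommGroup H]
  [modH : Module ℚ H]
  pair : H →ₗ[ℚ] H →ₗ[ℚ] ℚ
  pair_symm : ∀ a b, pair a b = pair b a
  h : H
  B : H
  h_sq : pair h h = 2
  s : H
  t : ℤ
  s_sq : pair s s - 4 * t = -2
  /-- `Pic S = ℤh`, and `s − 2B ∈ Pic S` -/
  s_sub_2B : ∃ m : ℤ, s - (2 : ℚ) • B = (m : ℚ) • h
  /-- `½·s·h − ½ ∈ ℤ`, i.e. `s·h` is odd -/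
  sh_odd : ∃ k : ℤ, pair s h = 2 * k + 1
  Obj : Type
  extDim : Obj → Obj → ℤ → ℕ
  rk : Obj → ℤ
  v : Obj → ℚ × H × ℚ
  v_rk : ∀ E, (v E).1 = (rk E : ℚ)
  chi : Obj → Obj → ℤ
  /-- Riemann–Roch: `χ(E,F) = −⟨v^B(E), v^B(F)⟩` -/
  chi_eq : ∀ E F, (chi E F : ℚ)
      = -(pair (v E).2.1 (v F).2.1 - (v E).1 * (v F).2.2 - (v E).2.2 * (v F).1)
  /-- `χ(E,E) = 2·dim Hom(E,E) − dim Ext¹(E,E)` (Serre duality on the CY2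
  category `D^b(S,α)`) -/
  chi_self : ∀ E, chi E E = 2 * (extDim E E 0 : ℤ) - extDim E E 1
  /-- the twisted Mukai lattice is generated by `(2,2B,0)`, `ℤh`, `(0,0,1)` -/
  v_mem : ∀ E, ∃ a b c : ℤ,
      v E = ((2 * a : ℚ), (2 * a : ℚ) • B + (b : ℚ) • h, (c : ℚ))

attribute [instance] VeryGeneralTwistedK3Cat.grpH VeryGeneralTwistedK3Cat.modH

namespace VeryGeneralTwistedK3Cat

variable (T : VeryGeneralTwistedK3Cat)

/-- `B̃ = ½·l + ¼·h + B = ½·s + ¼·h`, where `l = s − 2B ∈ Pic S` -/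
def Btilde : T.H := (1 / 2 : ℚ) • T.s + (1 / 4 : ℚ) • T.h

/-- the real part of the central charge `Z_λ(E) = ⟨v^B(E), e^{B̃+iλh}⟩`:
`Re Z_λ(r,c,d) = c·B̃ − (r/2)·B̃² − d + r·λ²` -/
def ReZ (lam : ℝ) (w : ℚ × T.H × ℚ) : ℝ :=
  ((T.pair w.2.1 T.Btilde - w.1 / 2 * T.pair T.Btilde T.Btilde - w.2.2 : ℚ) : ℝ)
    + (w.1 : ℝ) * lam ^ 2

/-- the imaginary part of the central charge `Z_λ(E) = ⟨v^B(E), e^{B̃+iλh}⟩`: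
`Im Z_λ(r,c,d) = λ·(c·h − r·B̃·h)` -/
def ImZ (lam : ℝ) (w : ℚ × T.H × ℚ) : ℝ :=
  lam * ((T.pair w.2.1 T.h - w.1 * T.pair T.Btilde T.h : ℚ) : ℝ)

end VeryGeneralTwistedK3Cat

theorem aux_key (T : VeryGeneralTwistedK3Cat) (lam : ℝ) (F : T.Obj)
    (hsimple : T.extDim F F 0 = 1) :
    ∃ (a n : ℤ) (x c : ℚ), T.rk F = 2 * a ∧
      T.v F = ((2 * a : ℚ), (a : ℚ) • T.s + (n : ℚ) • T.h, c) ∧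
      T.ImZ lam (T.v F) = lam * (2 * n - a) ∧
      T.ReZ lam (T.v F) = (x : ℝ) + 2 * a * lam ^ 2 ∧
      -2 - (2 * n - a : ℚ) ^ 2 / 2 ≤ 4 * a * x ∧
      4 * a * x = a ^ 2 * (4 * T.t - 2) + 2 * a * n * T.pair T.s T.h + 2 * n ^ 2
        - 4 * a * c - (2 * n - a : ℚ) ^ 2 / 2 := by
  obtain ⟨a, b, c, hv⟩ := T.v_mem F
  obtain ⟨m, hm⟩ := T.s_sub_2B
  have hB : (2 : ℚ) • T.B = T.s - (m : ℚ) • T.h := by rw [← hm]; abel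
  have hc : (2 * a : ℚ) • T.B + (b : ℚ) • T.h
      = (a : ℚ) • T.s + ((b - a * m : ℤ) : ℚ) • T.h := by
    have : (2 * a : ℚ) • T.B = (a : ℚ) • ((2 : ℚ) • T.B) := by
      rw [smul_smul, mul_comm]
    rw [this, hB]
    push_cast
    module
  rw [hc] at hv
  generalize b - a * m = n at hv
  have hs : T.pair T.s T.s = 4 * T.t - 2 := by linarith [T.s_sq]
  have hhs : T.pair T.h T.s = T.pair T.s T.h := T.pair_symm _ _
  have hchi := T.chi_eq F F
  have hself := T.chi_self F
  have hle : (T.chi F F : ℚ) ≤ 2 := by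
    have : T.chi F F ≤ 2 := by rw [hself, hsimple]; push_cast; omega
    exact_mod_cast this
  have hrk := T.v_rk F
  rw [hv] at hchi hrk
  simp only [map_add, map_smul, LinearMap.add_apply, LinearMap.smul_apply, smul_eq_mul,
    hs, hhs, T.h_sq] at hchi
  refine ⟨a, n, T.pair ((a : ℚ) • T.s + (n : ℚ) • T.h) T.Btilde
    - (2 * a) / 2 * T.pair T.Btilde T.Btilde - c, c, ?_, hv, ?_, ?_, ?_, ?_⟩
  · have : (T.rk F : ℚ) = 2 * a := hrk.symm
    exact_mod_cast this
  · rw [hv]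
    simp only [VeryGeneralTwistedK3Cat.ImZ, VeryGeneralTwistedK3Cat.Btilde, map_add, map_smul,
      LinearMap.add_apply, LinearMap.smul_apply, smul_eq_mul, T.h_sq]
    push_cast
    ring
  · rw [hv]
    simp only [VeryGeneralTwistedK3Cat.ReZ]
    push_cast
    ring
  · simp only [VeryGeneralTwistedK3Cat.Btilde, map_add, map_smul,
      LinearMap.add_apply, LinearMap.smul_apply, smul_eq_mul, T.h_sq, hs, hhs]
    linarith
  · simp only [VeryGeneralTwistedK3Cat.Btilde, map_add, map_smul,
      LinearMap.add_apply, LinearMap.smul_apply, smul_eq_mul, T.h_sq, hs, hhs]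
    ring

/-- Let `(S,α)` be the twisted K3 surface of a very general
cubic fourfold containing a plane, with `Pic S = ℤh`, and let `Z = Z_λ` be
the central charge `Z(E) = ⟨v^B(E), e^{B̃+iλh}⟩`, `λ > ½`.  Let
`F ∈ D^b(S,α)` satisfy `Hom(F,F) = ℂ`.
If `Im Z(F) = λ` and `rk F > 0`, then `Re Z(F) ≥ 2λ² − 5/8`, with equality if
and only if `v^B(F) = (2, s + h, t + ½·s·h + ½)`; if moreover `rk F ≥ 4`,
then `Re Z(F) ≥ 4λ² − 5/16`.
If `Im Z(F) = 2λ` and `rk F > 0`, then `Re Z(F) > 2λ² − 1`; if moreover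
`rk F ≥ 4`, then `Re Z(F) ≥ 4λ² − ½`. -/
theorem central_charge_inequalities (T : VeryGeneralTwistedK3Cat)
    (lam : ℝ) (hlam : 1 / 2 < lam) (F : T.Obj)
    (hsimple : T.extDim F F 0 = 1) :
    (T.ImZ lam (T.v F) = lam → 0 < T.rk F →
      (2 * lam ^ 2 - 5 / 8 ≤ T.ReZ lam (T.v F) ∧
        (T.ReZ lam (T.v F) = 2 * lam ^ 2 - 5 / 8 ↔
          T.v F = (2, T.s + T.h, (T.t : ℚ) + T.pair T.s T.h / 2 + 1 / 2)) ∧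
        (4 ≤ T.rk F → 4 * lam ^ 2 - 5 / 16 ≤ T.ReZ lam (T.v F)))) ∧
    (T.ImZ lam (T.v F) = 2 * lam → 0 < T.rk F →
      (2 * lam ^ 2 - 1 < T.ReZ lam (T.v F) ∧
        (4 ≤ T.rk F → 4 * lam ^ 2 - 1 / 2 ≤ T.ReZ lam (T.v F)))) := by
  obtain ⟨a, n, x, c, hrk, hv, him, hre, hx, hxe⟩ := aux_key T lam F hsimple
  have hl0 : lam ≠ 0 := by linarith
  have hl2 : 1 / 4 < lam ^ 2 := by nlinarith
  rw [him, hre, hrk]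
  have hxR : -2 - (2 * n - a : ℝ) ^ 2 / 2 ≤ 4 * a * x := by exact_mod_cast hx
  constructor
  · intro h1 h2
    have hna : (2 * n - a : ℝ) = 1 := mul_left_cancel₀ hl0 (by linarith)
    have hnaQ : (2 * n - a : ℚ) = 1 := by exact_mod_cast hna
    have hnaZ : 2 * n - a = 1 := by exact_mod_cast hna
    rw [hna] at hxR
    rw [hnaQ] at hxe
    have ha : 1 ≤ a := by omega
    have haR : (1 : ℝ) ≤ a := by exact_mod_cast ha
    have hx1 : -5 / 8 ≤ (x : ℝ) := by
      by_contra! hcon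
      nlinarith
    have h4 : 2 ≤ a → -5 / 16 ≤ (x : ℝ) := by
      intro h
      have : (2 : ℝ) ≤ a := by exact_mod_cast h
      by_contra! hcon
      nlinarith
    refine ⟨by nlinarith, ⟨?_, ?_⟩, ?_⟩
    · intro he
      have ha1 : a = 1 := by
        by_contra hne
        have h2a : 2 ≤ a := by omega
        have : (2 : ℝ) ≤ a := by exact_mod_cast h2a
        have := h4 h2a
        nlinarith
      have hn1 : n = 1 := by omega
      subst ha1 hn1
      have hxx : (x : ℝ) = ((-5 / 8 : ℚ) : ℝ) := by push_cast at he ⊢; linarith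
      have hxx' : x = -5 / 8 := by exact_mod_cast hxx
      have hcc : c = (T.t : ℚ) + T.pair T.s T.h / 2 + 1 / 2 := by
        rw [hxx'] at hxe
        push_cast at hxe
        linarith
      rw [hv, hcc]
      simp
    · intro he
      rw [hv] at he
      have e1 := congrArg Prod.fst he
      have e3 := congrArg (fun p => p.2.2) he
      simp only at e1 e3
      have ha1 : (a : ℚ) = 1 := by linarith
      have ha1' : a = 1 := by exact_mod_cast ha1
      have hn1 : n = 1 := by omega
      subst ha1' hn1
      have hxx' : x = -5 / 8 := by
        rw [e3] at hxe
        push_cast at hxe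
        linarith
      rw [hxx']
      push_cast
      ring
    · intro h
      have h2a : 2 ≤ a := by omega
      have : (2 : ℝ) ≤ a := by exact_mod_cast h2a
      have := h4 h2a
      nlinarith
  · intro h1 h2
    have hna : (2 * n - a : ℝ) = 2 := mul_left_cancel₀ hl0 (by linarith)
    have hnaZ : 2 * n - a = 2 := by exact_mod_cast hna
    rw [hna] at hxR
    have ha : 2 ≤ a := by omega
    have haR : (2 : ℝ) ≤ a := by exact_mod_cast ha
    have hx1 : -1 / 2 ≤ (x : ℝ) := by
      by_contra! hcon
      nlinarith
    exact ⟨by nlinarith, fun _ => by nlinarith⟩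
end
end
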